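/- arXiv:2102.06157 — 2 statements merged into one kernel-verified Lean document; each statement's English description precedes it below -/
import Mathlib

section
/- Let M be a metric space, V a compact topological space, Q a Hausdorff topological space, and λ ↦ x_λ a continuous map from Q to the space C(V,M) of continuous maps V → M with the compact-open topology. Let Ṽ ⊆ V be an open subset and v : Q → V a map with v(Q) ⊆ Ṽ such that λ ↦ x_λ(v(λ)) is a continuous map Q → M. If for every λ ∈ Q the map x_λ is injective on the closure of Ṽ, then v is continuous. -/
open Filter Topology in
/-- **Continuity of the point selection map.**
Let `M` be a metric space, `V` a compact topological space, `Q` a Hausdorff topological space,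
and `q ↦ F q` a continuous map `Q → C(V,M)` (compact-open topology). Let `Vt ⊆ V` be open and
`v : Q → V` a map with values in `Vt` such that `q ↦ F q (v q)` is continuous. If each `F q`
is injective on the closure of `Vt`, then `v` is continuous. -/
theorem continuous_of_selection
    {M V Q : Type*} [MetricSpace M] [TopologicalSpace V] [CompactSpace V]
    [TopologicalSpace Q] [T2Space Q]
    (F : Q → C(V, M)) (hF : Continuous F)
    (Vt : Set V) (hVt : IsOpen Vt)
    (v : Q → V) (hvQ : ∀ q, v q ∈ Vt)
    (hxv : Continuous fun q => F q (v q))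
    (hinj : ∀ q, Set.InjOn (F q) (closure Vt)) :
    Continuous v := by
  refine continuous_iff_continuousAt.2 fun q₀ => ?_
  have hunif : TendstoUniformly (fun q => ⇑(F q)) (F q₀) (𝓝 q₀) :=
    ContinuousMap.tendsto_iff_tendstoUniformly.1 hF.continuousAt
  have hlim : Tendsto (fun q => F q₀ (v q)) (𝓝 q₀) (𝓝 (F q₀ (v q₀))) := by
    refine Metric.tendsto_nhds.2 fun ε hε => ?_
    filter_upwards [Metric.tendstoUniformly_iff.1 hunif (ε / 2) (half_pos hε),
      Metric.tendsto_nhds.1 (hxv.tendsto q₀) (ε / 2) (half_pos hε)] with q h₁ h₂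
    linarith [dist_triangle (F q₀ (v q)) (F q (v q)) (F q₀ (v q₀)), h₁ (v q)]
  refine tendsto_nhds.2 fun U hU hvU => ?_
  have hK : IsClosed (F q₀ '' (closure Vt \ U)) :=
    ((isClosed_closure.sdiff hU).isCompact.image (F q₀).continuous).isClosed
  have hnot : F q₀ (v q₀) ∉ F q₀ '' (closure Vt \ U) := by
    rintro ⟨x, ⟨hx, hxU⟩, h⟩
    exact hxU (hinj q₀ hx (subset_closure (hvQ q₀)) h ▸ hvU)
  filter_upwards [hlim (hK.isOpen_compl.mem_nhds hnot)] with q hq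
  by_contra hqU
  exact hq ⟨v q, ⟨subset_closure (hvQ q), hqU⟩, rfl⟩
end

section
/- Let r > 0, Δ_r = {λ ∈ ℂ : |λ| < r}, let Ṽ be a C¹ manifold (finite-dimensional, possibly with boundary), let x̃, ỹ : Ṽ → ℂ^m be C¹ maps, and let v : Δ_r → Ṽ be a continuous map such that the function h : Δ_r → ℂ^m defined by h(λ) = ỹ(v(λ)) + λ·x̃(v(λ)) is holomorphic. (a) If for every λ ∈ Δ_r the map ỹ + λ·x̃ : Ṽ → ℂ^m is a C¹ embedding, then v is real differentiable at every point of Δ_r. (b) If, in addition, ỹ + λ·x̃ is totally real for every λ ∈ Δ_r, then v is constant. -/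
open scoped Manifold
open Asymptotics Filter Topology

/-- If `F ∘ u` is differentiable at `l₀`, where `u` is continuous at `l₀` and `F` has an injective
derivative at `u l₀`, then `u` is differentiable at `l₀`. -/
theorem exists_hasFDerivAt_of_comp_of_injective
    {W E G : Type*} [NormedAddCommGroup W] [NormedSpace ℝ W]
    [NormedAddCommGroup E] [NormedSpace ℝ E] [FiniteDimensional ℝ E]
    [NormedAddCommGroup G] [NormedSpace ℝ G] [FiniteDimensional ℝ G]
    {F : E → G} {L : E →L[ℝ] G} {s : Set E} {u : W → E} {l₀ : W} {B : W →L[ℝ] G}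
    (hF : HasFDerivWithinAt F L s (u l₀)) (hL : Function.Injective L)
    (hu : ContinuousAt u l₀) (hus : ∀ᶠ l in 𝓝 l₀, u l ∈ s)
    (hB : HasFDerivAt (fun l => F (u l)) B l₀) :
    ∃ A : W →L[ℝ] E, HasFDerivAt u A l₀ ∧ L.comp A = B := by
  obtain ⟨P, hP⟩ := LinearMap.exists_leftInverse_of_injective (L : E →ₗ[ℝ] G)
    (LinearMap.ker_eq_bot.mpr hL)
  set Q : G →L[ℝ] E := LinearMap.toContinuousLinearMap P
  have hQ : ∀ e, Q (L e) = e := fun e => LinearMap.congr_fun hP e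
  have hut : Tendsto u (𝓝 l₀) (𝓝[s] (u l₀)) := tendsto_nhdsWithin_iff.mpr ⟨hu, hus⟩
  have h₁ : (fun l => F (u l) - F (u l₀) - L (u l - u l₀)) =o[𝓝 l₀] fun l => u l - u l₀ :=
    hF.isLittleO.comp_tendsto hut
  have h₂ : (fun l => u l - u l₀) =O[𝓝 l₀] fun l => L (u l - u l₀) := by
    simpa only [hQ] using Q.isBigO_comp (fun l => L (u l - u l₀)) (𝓝 l₀)
  have h₃ : (fun l => L (u l - u l₀)) =O[𝓝 l₀] fun l => F (u l) - F (u l₀) := by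
    simpa using (h₁.trans_isBigO h₂).right_isBigO_add
  have h₄ : (fun l => u l - u l₀) =O[𝓝 l₀] fun l => l - l₀ :=
    (h₂.trans h₃).trans hB.isBigO_sub
  have h₅ : (fun l => L (u l - u l₀) - B (l - l₀)) =o[𝓝 l₀] fun l => l - l₀ := by
    refine (hB.isLittleO.sub (h₁.trans_isBigO h₄)).congr_left fun l => ?_
    abel
  have hA : HasFDerivAt u (Q.comp B) l₀ := by
    refine .of_isLittleO (((Q.isBigO_comp _ _).trans_isLittleO h₅).congr_left fun l => ?_)
    simp only [map_sub Q, hQ, ContinuousLinearMap.comp_apply]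
  exact ⟨_, hA, (hF.comp_hasFDerivAt l₀ hA hus).unique hB⟩

/-- Manifold version of `exists_hasFDerivAt_of_comp_of_injective`. -/
theorem exists_hasMFDerivAt_of_comp_of_injective
    {W E G : Type*} [NormedAddCommGroup W] [NormedSpace ℝ W]
    [NormedAddCommGroup E] [NormedSpace ℝ E] [FiniteDimensional ℝ E]
    [NormedAddCommGroup G] [NormedSpace ℝ G] [FiniteDimensional ℝ G]
    {H : Type*} [TopologicalSpace H] {I : ModelWithCorners ℝ E H}
    {M : Type*} [TopologicalSpace M] [ChartedSpace H M]
    {F : M → G} {L : E →L[ℝ] G} {v : W → M} {l₀ : W} {B : W →L[ℝ] G}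
    (hF : HasMFDerivAt I 𝓘(ℝ, G) F (v l₀) L) (hL : Function.Injective L)
    (hv : ContinuousAt v l₀) (hB : HasFDerivAt (fun l => F (v l)) B l₀) :
    ∃ A : W →L[ℝ] E, HasMFDerivAt 𝓘(ℝ, W) I v l₀ A ∧ L.comp A = B := by
  have hsrc : ∀ᶠ l in 𝓝 l₀, v l ∈ (extChartAt I (v l₀)).source :=
    hv.eventually (extChartAt_source_mem_nhds (I := I) (v l₀))
  obtain ⟨A, hA, hAB⟩ := exists_hasFDerivAt_of_comp_of_injective
    (F := writtenInExtChartAt I 𝓘(ℝ, G) (v l₀) F) (u := fun l => extChartAt I (v l₀) (v l))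
    (B := B) hF.2 hL ((continuousAt_extChartAt (I := I) (v l₀)).comp hv)
    (Eventually.of_forall fun l => ⟨_, rfl⟩)
    (hB.congr_of_eventuallyEq (hsrc.mono fun l hl =>
      congrArg F ((extChartAt I (v l₀)).left_inv hl)))
  exact ⟨A, ⟨hv, hA.hasFDerivWithinAt⟩, hAB⟩

/-- **Holomorphic point selection along C¹ embeddings (Proposition 3.3).**
Let `Vt` be a C¹ manifold, `x y : Vt → ℂ^m` C¹ maps, and `v : Δ_r → Vt` continuous such that
`h(λ) = y(v λ) + λ • x(v λ)` is holomorphic on `Δ_r = {|λ| < r}`.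
(a) If `y + λ • x` is a C¹ embedding for every `λ ∈ Δ_r`, then `v` is real differentiable on
`Δ_r`. (b) If moreover `y + λ • x` is totally real for every `λ ∈ Δ_r`, then `v` is constant. -/
theorem selection_differentiable_and_constant_of_totally_real
    {r : ℝ} (hr : 0 < r)
    {E : Type*} [NormedAddCommGroup E] [NormedSpace ℝ E] [FiniteDimensional ℝ E]
    {H : Type*} [TopologicalSpace H] {I : ModelWithCorners ℝ E H}
    {Vt : Type*} [TopologicalSpace Vt] [T2Space Vt] [ChartedSpace H Vt]
    [HasGroupoid Vt (contDiffGroupoid 1 I)]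
    {m : ℕ}
    (x y : Vt → EuclideanSpace ℂ (Fin m))
    (hx : ContMDiff I 𝓘(ℝ, EuclideanSpace ℂ (Fin m)) 1 x)
    (hy : ContMDiff I 𝓘(ℝ, EuclideanSpace ℂ (Fin m)) 1 y)
    (v : ℂ → Vt) (hv : ContinuousOn v (Metric.ball 0 r))
    (hh : DifferentiableOn ℂ (fun l : ℂ => y (v l) + l • x (v l)) (Metric.ball 0 r))
    (hemb : ∀ l ∈ Metric.ball (0 : ℂ) r,
      Topology.IsEmbedding (fun p : Vt => y p + l • x p) ∧
      ∀ p : Vt, Function.Injective fun u : E =>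
        (mfderiv I 𝓘(ℝ, EuclideanSpace ℂ (Fin m)) (fun q : Vt => y q + l • x q) p u :
          EuclideanSpace ℂ (Fin m))) :
    (∀ l ∈ Metric.ball (0 : ℂ) r, MDifferentiableAt 𝓘(ℝ, ℂ) I v l) ∧
    ((∀ l ∈ Metric.ball (0 : ℂ) r, ∀ p : Vt, ∀ z : EuclideanSpace ℂ (Fin m),
        (z ∈ Set.range fun u : E =>
          (mfderiv I 𝓘(ℝ, EuclideanSpace ℂ (Fin m)) (fun q : Vt => y q + l • x q) p u :
            EuclideanSpace ℂ (Fin m))) →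
        (Complex.I • z ∈ Set.range fun u : E =>
          (mfderiv I 𝓘(ℝ, EuclideanSpace ℂ (Fin m)) (fun q : Vt => y q + l • x q) p u :
            EuclideanSpace ℂ (Fin m))) →
        z = 0) →
      ∀ l₁ ∈ Metric.ball (0 : ℂ) r, ∀ l₂ ∈ Metric.ball (0 : ℂ) r, v l₁ = v l₂) := by
  have hmx : ∀ p, MDifferentiableAt I 𝓘(ℝ, EuclideanSpace ℂ (Fin m)) x p :=
    fun p => (hx p).mdifferentiableAt one_ne_zero
  have hmy : ∀ p, MDifferentiableAt I 𝓘(ℝ, EuclideanSpace ℂ (Fin m)) y p :=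
    fun p => (hy p).mdifferentiableAt one_ne_zero
  have hmxy : ∀ (l : ℂ) p, MDifferentiableAt I 𝓘(ℝ, EuclideanSpace ℂ (Fin m))
      (fun q => y q + l • x q) p := by
    intro l p
    have hlx : MDifferentiableAt I 𝓘(ℝ, EuclideanSpace ℂ (Fin m)) (fun q => l • x q) p :=
      MDifferentiableAt.comp p
        (DifferentiableAt.mdifferentiableAt (f := fun z : EuclideanSpace ℂ (Fin m) => l • z)
          (differentiableAt_id.const_smul l)) (hmx p)
    exact (hmy p).add hlx
  have key : ∀ l ∈ Metric.ball (0 : ℂ) r, ∃ (A : ℂ →L[ℝ] E) (c : EuclideanSpace ℂ (Fin m)),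
      HasMFDerivAt 𝓘(ℝ, ℂ) I v l A ∧ ∀ w : ℂ,
        (mfderiv I 𝓘(ℝ, EuclideanSpace ℂ (Fin m)) (fun q : Vt => y q + l • x q) (v l) (A w) :
          EuclideanSpace ℂ (Fin m)) = w • c := by
    intro l hl
    have hnhds := Metric.isOpen_ball.mem_nhds hl
    have hvl : ContinuousAt v l := hv.continuousAt hnhds
    obtain ⟨c, hc⟩ : ∃ c, HasDerivAt (fun k : ℂ => y (v k) + k • x (v k)) c l :=
      ⟨_, (hh.differentiableAt hnhds).hasDerivAt⟩
    have hxv : HasDerivAt (fun k : ℂ => (k - l) • x (v k)) (x (v l)) l := by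
      rw [hasDerivAt_iff_tendsto_slope]
      refine (((hx (v l)).continuousAt.comp hvl).tendsto.mono_left nhdsWithin_le_nhds).congr' ?_
      filter_upwards [self_mem_nhdsWithin] with k hk
      simp [slope_def_module, smul_smul, inv_mul_cancel₀ (sub_ne_zero.mpr hk)]
    have hd : HasDerivAt (fun k : ℂ => y (v k) + l • x (v k)) (c - x (v l)) l := by
      refine (hc.sub hxv).congr_of_eventuallyEq (Eventually.of_forall fun k => ?_)
      simp only [Pi.sub_apply, sub_smul]
      abel
    obtain ⟨A, hA, hAB⟩ := exists_hasMFDerivAt_of_comp_of_injective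
      (hmxy l (v l)).hasMFDerivAt ((hemb l hl).2 (v l)) hvl
      (hd.hasFDerivAt.restrictScalars ℝ)
    refine ⟨A, c - x (v l), hA, fun w => ?_⟩
    exact (DFunLike.congr_fun hAB w).trans (by simp)
  refine ⟨fun l hl => ?_, fun htr => ?_⟩
  · obtain ⟨A, c, hA, -⟩ := key l hl
    exact hA.mdifferentiableAt
  have hzero : ∀ l ∈ Metric.ball (0 : ℂ) r, HasMFDerivAt 𝓘(ℝ, ℂ) I v l (0 : ℂ →L[ℝ] E) := by
    intro l hl
    obtain ⟨A, c, hA, hc⟩ := key l hl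
    have hc0 : c = 0 := htr l hl (v l) c ⟨A 1, by simpa using hc 1⟩ ⟨A Complex.I, hc Complex.I⟩
    have hA0 : A = 0 := by
      ext1 w
      refine (hemb l hl).2 (v l) ((hc w).trans ?_)
      rw [hc0, smul_zero]
      exact (map_zero _).symm
    exact hA0 ▸ hA
  have hconst : ∀ l ∈ Metric.ball (0 : ℂ) r, HasFDerivAt (fun k => y (v k) + (0 : ℂ) • x (v k))
      (0 : ℂ →L[ℝ] EuclideanSpace ℂ (Fin m)) l := by
    intro l hl
    have := ((hmxy 0 (v l)).hasMFDerivAt.comp l (hzero l hl)).hasFDerivAt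
    refine this.congr_fderiv ?_
    exact ContinuousLinearMap.comp_zero _
  intro l₁ h₁ l₂ h₂
  refine (hemb 0 (Metric.mem_ball_self hr)).1.injective ?_
  exact (convex_ball (0 : ℂ) r).is_const_of_fderivWithin_eq_zero (𝕜 := ℝ)
    (fun l hl => (hconst l hl).differentiableAt.differentiableWithinAt)
    (fun l hl => by
      rw [fderivWithin_of_isOpen Metric.isOpen_ball hl]
      exact (hconst l hl).fderiv) h₁ h₂
end
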